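/- Let δ ∈ [0,2) and suppose there exist r > 0 and a > 0 such that the boundary Hardy inequality with constant a holds on Γ_r. Then a_δ(Γ) = b_δ(Γ) = b_δ(Ω), and moreover a_δ(Γ∩U) = b_δ(Γ∩U) for every bounded open subset U ⊆ ℝ^d. -/

import Mathlib

open MeasureTheory Metric Set ENNReal RealInnerProductSpace

noncomputable section

/-- The Euclidean distance from `x` to the boundary `Γ = ∂Ω` of `Ω`. -/
def distB {d : ℕ} (Ω : Set (EuclideanSpace ℝ (Fin d))) (x : EuclideanSpace ℝ (Fin d)) : ℝ :=
  Metric.infDist x (frontier Ω)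

/-- The boundary layer `Γ_r = {x ∈ Ω : d_Γ(x) < r}`. -/
def bdryLayer {d : ℕ} (Ω : Set (EuclideanSpace ℝ (Fin d))) (r : ℝ) :
    Set (EuclideanSpace ℝ (Fin d)) :=
  {x | x ∈ Ω ∧ distB Ω x < r}

/-- `C_c^1` real functions with compact support contained in `U`. -/
def IsCc1 {d : ℕ} (U : Set (EuclideanSpace ℝ (Fin d)))
    (ψ : EuclideanSpace ℝ (Fin d) → ℝ) : Prop :=
  ContDiff ℝ 1 ψ ∧ HasCompactSupport ψ ∧ tsupport ψ ⊆ U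

/-- The `L²` norm with respect to Lebesgue measure. -/
def L2N {d : ℕ} (f : EuclideanSpace ℝ (Fin d) → ℝ) : ℝ≥0∞ :=
  eLpNorm f 2 volume

/-- The weighted norm `‖d_Γ^p ψ‖₂`. -/
def wNorm {d : ℕ} (Ω : Set (EuclideanSpace ℝ (Fin d))) (p : ℝ)
    (ψ : EuclideanSpace ℝ (Fin d) → ℝ) : ℝ≥0∞ :=
  L2N (fun x => distB Ω x ^ p * ψ x)

/-- The weighted gradient norm `‖d_Γ^p |∇ψ|‖₂`. -/
def wGradNorm {d : ℕ} (Ω : Set (EuclideanSpace ℝ (Fin d))) (p : ℝ)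
    (ψ : EuclideanSpace ℝ (Fin d) → ℝ) : ℝ≥0∞ :=
  L2N (fun x => distB Ω x ^ p * ‖fderiv ℝ ψ x‖)

/-- The (boundary) Hardy inequality `‖d_Γ^{δ/2-1}ψ‖₂ ≤ a ‖d_Γ^{δ/2}|∇ψ|‖₂`
with constant `a` for all test functions `ψ ∈ C_c^1(S)`. -/
def BHardy {d : ℕ} (Ω : Set (EuclideanSpace ℝ (Fin d))) (δ : ℝ)
    (S : Set (EuclideanSpace ℝ (Fin d))) (a : ℝ) : Prop :=
  ∀ ψ, IsCc1 S ψ → wNorm Ω (δ/2 - 1) ψ ≤ ENNReal.ofReal a * wGradNorm Ω (δ/2) ψ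

/-- The weak Hardy inequality `‖d_Γ^{δ/2-1}ψ‖₂ ≤ b ‖d_Γ^{δ/2}|∇ψ|‖₂ + c ‖ψ‖₂`
with constants `b, c` for all test functions `ψ ∈ C_c^1(S)`. -/
def WHardy {d : ℕ} (Ω : Set (EuclideanSpace ℝ (Fin d))) (δ : ℝ)
    (S : Set (EuclideanSpace ℝ (Fin d))) (b c : ℝ) : Prop :=
  ∀ ψ, IsCc1 S ψ →
    wNorm Ω (δ/2 - 1) ψ ≤ ENNReal.ofReal b * wGradNorm Ω (δ/2) ψ + ENNReal.ofReal c * L2N ψ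

/-- The optimal Hardy constant for test functions supported in `S`
(the infimum of the `a > 0` for which the Hardy inequality holds on `S`;
`∞` if there is no such constant). -/
def hardyConstS {d : ℕ} (Ω : Set (EuclideanSpace ℝ (Fin d))) (δ : ℝ)
    (S : Set (EuclideanSpace ℝ (Fin d))) : ℝ≥0∞ :=
  sInf {t | ∃ a : ℝ, 0 < a ∧ t = ENNReal.ofReal a ∧ BHardy Ω δ S a}

/-- The boundary Hardy constant `a_δ(Γ) = inf_{r>0} a_δ(Γ_r)`. -/
def hardyConst {d : ℕ} (Ω : Set (EuclideanSpace ℝ (Fin d))) (δ : ℝ) : ℝ≥0∞ :=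
  ⨅ (r : ℝ) (_ : 0 < r), hardyConstS Ω δ (bdryLayer Ω r)

/-- The local boundary Hardy constant `a_δ(Γ ∩ U) = inf_{r>0} a_δ(Γ_r ∩ U)`. -/
def hardyConstOn {d : ℕ} (Ω : Set (EuclideanSpace ℝ (Fin d))) (δ : ℝ)
    (U : Set (EuclideanSpace ℝ (Fin d))) : ℝ≥0∞ :=
  ⨅ (r : ℝ) (_ : 0 < r), hardyConstS Ω δ (bdryLayer Ω r ∩ U)

/-- The weak Hardy constant `b_δ(Ω)`: the infimum of the `b > 0` for which there
is a `c > 0` such that the weak Hardy inequality holds on `Ω`. -/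
def weakConstDomain {d : ℕ} (Ω : Set (EuclideanSpace ℝ (Fin d))) (δ : ℝ) : ℝ≥0∞ :=
  sInf {t | ∃ b c : ℝ, 0 < b ∧ 0 < c ∧ t = ENNReal.ofReal b ∧ WHardy Ω δ Ω b c}

/-- The weak Hardy constant `b_δ(Γ)`: the infimum of the `b > 0` for which there
are `r > 0` and `c > 0` such that the weak Hardy inequality holds on `Γ_r`. -/
def weakConstBdry {d : ℕ} (Ω : Set (EuclideanSpace ℝ (Fin d))) (δ : ℝ) : ℝ≥0∞ :=
  sInf {t | ∃ b c r : ℝ, 0 < b ∧ 0 < c ∧ 0 < r ∧ t = ENNReal.ofReal b ∧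
    WHardy Ω δ (bdryLayer Ω r) b c}

/-- The weak Hardy constant `b_δ(Γ ∩ U)`. -/
def weakConstOn {d : ℕ} (Ω : Set (EuclideanSpace ℝ (Fin d))) (δ : ℝ)
    (U : Set (EuclideanSpace ℝ (Fin d))) : ℝ≥0∞ :=
  sInf {t | ∃ b c r : ℝ, 0 < b ∧ 0 < c ∧ 0 < r ∧ t = ENNReal.ofReal b ∧
    WHardy Ω δ (bdryLayer Ω r ∩ U) b c}

/-- A domain: a nonempty open connected proper subset of `ℝ^d`. -/
def IsDomainSet {d : ℕ} (Ω : Set (EuclideanSpace ℝ (Fin d))) : Prop :=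
  IsOpen Ω ∧ IsConnected Ω ∧ Ω ≠ Set.univ

/-- A `C¹` cutoff, with bounded gradient, between two neighbourhoods of a set `S`. -/
theorem exists_contDiff_cutoff_infDist {d : ℕ} (S : Set (EuclideanSpace ℝ (Fin d))) {r : ℝ}
    (hr : 0 < r) :
    ∃ (χ : EuclideanSpace ℝ (Fin d) → ℝ) (C : ℝ), 0 ≤ C ∧ ContDiff ℝ 1 χ ∧
      (∀ x, 0 ≤ χ x ∧ χ x ≤ 1) ∧ (∀ x, ‖fderiv ℝ χ x‖ ≤ C) ∧
      (∀ x, infDist x S ≤ r / 8 → χ x = 1) ∧ (∀ x, 5 * r / 8 ≤ infDist x S → χ x = 0) := by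
  set h : EuclideanSpace ℝ (Fin d) → ℝ := fun x => max 0 (min 1 (2 - 4 / r * infDist x S)) with hh
  have h01 : ∀ x, 0 ≤ h x ∧ h x ≤ 1 := fun x =>
    ⟨le_max_left _ _, max_le zero_le_one (min_le_left _ _)⟩
  have hdist : ∀ x y, |infDist x S - infDist y S| ≤ dist x y := fun x y => by
    simpa [Real.dist_eq] using (lipschitz_infDist_pt S).dist_le_mul x y
  have hlip : ∀ x y, |h x - h y| ≤ 4 / r * dist x y := by
    intro x y
    calc |h x - h y|
        ≤ |(2 - 4 / r * infDist x S) - (2 - 4 / r * infDist y S)| := by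
          exact (abs_max_sub_max_le_max 0 _ 0 _).trans (max_le (by simp)
            ((abs_min_sub_min_le_max 1 _ 1 _).trans (max_le (by simp) le_rfl)))
      _ = 4 / r * |infDist x S - infDist y S| := by
          rw [← abs_of_pos (div_pos four_pos hr), ← abs_mul, abs_of_pos (div_pos four_pos hr),
            ← abs_neg]
          congr 1
          ring
      _ ≤ 4 / r * dist x y := by gcongr; exact hdist x y
  have hcont : Continuous h := by
    have := continuous_infDist_pt S
    fun_prop
  let φ : ContDiffBump (0 : EuclideanSpace ℝ (Fin d)) :=
    ⟨r / 16, r / 8, by positivity, by linarith⟩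
  let χ : EuclideanSpace ℝ (Fin d) → ℝ :=
    convolution (φ.normed volume) h (ContinuousLinearMap.lsmul ℝ ℝ) volume
  have hφi : ∀ x, Integrable (fun t => φ.normed volume t * h (x - t)) := fun x => by
    refine Continuous.integrable_of_hasCompactSupport ?_ (φ.hasCompactSupport_normed.mul_right)
    exact φ.continuous_normed.mul (hcont.comp (by fun_prop))
  have hχ : ∀ x, χ x = ∫ t, φ.normed volume t * h (x - t) := fun x => rfl
  have hball : ∀ x c : EuclideanSpace ℝ (Fin d), x ∈ ball c φ.rOut →
      |infDist x S - infDist c S| < r / 8 := fun x c hx =>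
    (hdist x c).trans_lt hx
  have hconst : ∀ x c, (∀ y ∈ ball x φ.rOut, h y = c) → χ x = c := by
    intro x c hy
    have hx := hy x (mem_ball_self φ.rOut_pos)
    rw [← hx]
    exact φ.normed_convolution_eq_right fun y hyx => (hy y hyx).trans hx.symm
  refine ⟨χ, 4 / r, by positivity, ?_, ?_, ?_, ?_, ?_⟩
  · exact φ.hasCompactSupport_normed.contDiff_convolution_left _ φ.contDiff_normed
      hcont.locallyIntegrable
  · intro x
    have := dist_convolution_le (x₀ := x) (z₀ := (1 / 2 : ℝ)) (ε := 1 / 2) (by norm_num)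
      φ.support_normed_eq.subset φ.nonneg_normed (φ.integral_normed (μ := volume))
      hcont.aestronglyMeasurable (fun y _ => by
        rw [Real.dist_eq, abs_le]
        constructor <;> linarith [(h01 y).1, (h01 y).2])
    rw [Real.dist_eq, abs_le] at this
    exact ⟨by linarith [this.1], by linarith [this.2]⟩
  · intro x
    have hL : LipschitzWith (Real.toNNReal (4 / r)) χ := by
      refine LipschitzWith.of_dist_le_mul fun x y => ?_
      rw [Real.coe_toNNReal _ (by positivity), Real.dist_eq, hχ, hχ,
        ← integral_sub (hφi x) (hφi y), ← Real.norm_eq_abs]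
      calc ‖∫ t, (φ.normed volume t * h (x - t) - φ.normed volume t * h (y - t))‖
          ≤ ∫ t, φ.normed volume t * (4 / r * dist x y) := by
            refine norm_integral_le_of_norm_le (φ.integrable_normed.mul_const _)
              (Filter.Eventually.of_forall fun t => ?_)
            rw [← mul_sub, norm_mul, Real.norm_of_nonneg (φ.nonneg_normed t)]
            refine mul_le_mul_of_nonneg_left ?_ (φ.nonneg_normed t)
            simpa using hlip (x - t) (y - t)
        _ = 4 / r * dist x y := by
            rw [integral_mul_const, φ.integral_normed, one_mul]
    simpa [Real.coe_toNNReal _ (show 0 ≤ 4 / r by positivity)] using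
      norm_fderiv_le_of_lipschitz ℝ hL (x₀ := x)
  · intro x hx
    refine hconst x 1 fun y hy => ?_
    have h1 : infDist y S ≤ r / 4 := by linarith [(abs_lt.1 (hball y x hy)).2]
    have h2 : 4 / r * infDist y S ≤ 4 / r * (r / 4) := by gcongr
    have h3 : 4 / r * (r / 4) = 1 := by field_simp
    simp only [hh]
    rw [min_eq_left (by linarith), max_eq_right zero_le_one]
  · intro x hx
    refine hconst x 0 fun y hy => ?_
    have h1 : r / 2 ≤ infDist y S := by linarith [(abs_lt.1 (hball y x hy)).1]
    have h2 : 4 / r * (r / 2) ≤ 4 / r * infDist y S := by gcongr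
    have h3 : 4 / r * (r / 2) = 2 := by field_simp; norm_num
    exact max_eq_left ((min_le_right _ _).trans (by linarith))

theorem IsCc1.mono {d : ℕ} {S T : Set (EuclideanSpace ℝ (Fin d))}
    {ψ : EuclideanSpace ℝ (Fin d) → ℝ} (h : IsCc1 S ψ) (hST : S ⊆ T) : IsCc1 T ψ :=
  ⟨h.1, h.2.1, h.2.2.trans hST⟩

theorem distB_pos {d : ℕ} {Ω : Set (EuclideanSpace ℝ (Fin d))} (hΩ : IsDomainSet Ω)
    {x : EuclideanSpace ℝ (Fin d)} (hx : x ∈ Ω) : 0 < distB Ω x := by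
  have hne : (frontier Ω).Nonempty := nonempty_frontier_iff.2 ⟨hΩ.2.1.nonempty, hΩ.2.2⟩
  refine (isClosed_frontier.notMem_iff_infDist_pos hne).1 fun hf => ?_
  rw [hΩ.1.frontier_eq] at hf
  exact hf.2 hx

theorem continuous_distB {d : ℕ} (Ω : Set (EuclideanSpace ℝ (Fin d))) : Continuous (distB Ω) :=
  continuous_infDist_pt _

theorem distB_nonneg {d : ℕ} (Ω : Set (EuclideanSpace ℝ (Fin d)))
    (x : EuclideanSpace ℝ (Fin d)) : 0 ≤ distB Ω x :=
  infDist_nonneg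

theorem L2N_le_mul {d : ℕ} {f g : EuclideanSpace ℝ (Fin d) → ℝ} {C : ℝ}
    (h : ∀ x, |f x| ≤ C * |g x|) : L2N f ≤ ENNReal.ofReal C * L2N g :=
  eLpNorm_le_mul_eLpNorm_of_ae_le_mul (Filter.Eventually.of_forall h) 2

theorem wNorm_lt_top {d : ℕ} {Ω : Set (EuclideanSpace ℝ (Fin d))} (hΩ : IsDomainSet Ω)
    {p : ℝ} (hp : p ≤ 0) {ψ : EuclideanSpace ℝ (Fin d) → ℝ} (hψ : IsCc1 Ω ψ) :
    wNorm Ω p ψ < ⊤ := by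
  obtain ⟨m, hm, hmd⟩ : ∃ m > 0, ∀ x ∈ tsupport ψ, m ≤ distB Ω x := by
    rcases (tsupport ψ).eq_empty_or_nonempty with he | hne
    · exact ⟨1, one_pos, by simp [he]⟩
    · obtain ⟨x, hx, hmin⟩ := hψ.2.1.isCompact.exists_isMinOn hne (continuous_distB Ω).continuousOn
      exact ⟨distB Ω x, distB_pos hΩ (hψ.2.2 hx), fun y hy => hmin hy⟩
  have hle : wNorm Ω p ψ ≤ ENNReal.ofReal (m ^ p) * L2N ψ := by
    refine L2N_le_mul fun x => ?_
    by_cases hx : x ∈ tsupport ψ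
    · rw [abs_mul, abs_of_nonneg (Real.rpow_nonneg (distB_nonneg Ω x) _)]
      exact mul_le_mul_of_nonneg_right (Real.rpow_le_rpow_of_nonpos hm (hmd x hx) hp)
        (abs_nonneg _)
    · simp [image_eq_zero_of_notMem_tsupport hx]
  refine hle.trans_lt (ENNReal.mul_lt_top ENNReal.ofReal_lt_top ?_)
  exact (hψ.1.continuous.memLp_of_hasCompactSupport hψ.2.1).2

/-- In a thin boundary layer the `L²` norm is dominated by a small multiple of the weighted
norm. -/
theorem L2N_le_mul_wNorm {d : ℕ} {Ω : Set (EuclideanSpace ℝ (Fin d))} (hΩ : IsDomainSet Ω)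
    {q s : ℝ} (hq : 0 ≤ q) {ψ : EuclideanSpace ℝ (Fin d) → ℝ} (hψ : IsCc1 (bdryLayer Ω s) ψ) :
    L2N ψ ≤ ENNReal.ofReal (s ^ q) * wNorm Ω (-q) ψ := by
  refine L2N_le_mul fun x => ?_
  by_cases hx : x ∈ tsupport ψ
  · obtain ⟨hxΩ, hxs⟩ := hψ.2.2 hx
    have hpos := distB_pos hΩ hxΩ
    rw [abs_mul, abs_of_pos (Real.rpow_pos_of_pos hpos _), ← mul_assoc]
    refine le_mul_of_one_le_left (abs_nonneg _) ?_
    rw [Real.rpow_neg hpos.le, ← div_eq_mul_inv, one_le_div (Real.rpow_pos_of_pos hpos _)]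
    exact Real.rpow_le_rpow hpos.le hxs.le hq
  · simp [image_eq_zero_of_notMem_tsupport hx]

/-- A weak Hardy inequality on a boundary layer yields a Hardy inequality, with any larger
constant, on a thinner boundary layer. -/
theorem WHardy.exists_bHardy {d : ℕ} {Ω : Set (EuclideanSpace ℝ (Fin d))} (hΩ : IsDomainSet Ω)
    {δ : ℝ} (hδ : δ < 2) {U : Set (EuclideanSpace ℝ (Fin d))} {b b' c r : ℝ}
    (hb : 0 < b) (hbb' : b < b') (hc : 0 < c) (hr : 0 < r)
    (h : WHardy Ω δ (bdryLayer Ω r ∩ U) b c) :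
    ∃ s > 0, BHardy Ω δ (bdryLayer Ω s ∩ U) b' := by
  have hb' : 0 < b' := hb.trans hbb'
  set q : ℝ := 1 - δ / 2 with hq
  have hq0 : 0 < q := by linarith
  set η : ℝ := (1 - b / b') / c with hη
  have hη0 : 0 < η := div_pos (sub_pos.2 ((div_lt_one hb').2 hbb')) hc
  set s : ℝ := min r (η ^ q⁻¹)
  have hs0 : 0 < s := lt_min hr (Real.rpow_pos_of_pos hη0 _)
  have hsq : s ^ q ≤ η := by
    calc s ^ q ≤ (η ^ q⁻¹) ^ q := Real.rpow_le_rpow hs0.le (min_le_right _ _) hq0.le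
      _ = η := Real.rpow_inv_rpow hη0.le hq0.ne'
  refine ⟨s, hs0, fun ψ hψ => ?_⟩
  have hψs : IsCc1 (bdryLayer Ω s) ψ := hψ.mono inter_subset_left
  have hψr : IsCc1 (bdryLayer Ω r ∩ U) ψ :=
    hψ.mono (inter_subset_inter_left U fun x hx => ⟨hx.1, hx.2.trans_le (min_le_left _ _)⟩)
  have hWtop : wNorm Ω (δ / 2 - 1) ψ ≠ ⊤ :=
    (wNorm_lt_top hΩ (by linarith) (hψs.mono fun x hx => hx.1)).ne
  have hL := L2N_le_mul_wNorm hΩ hq0.le hψs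
  rw [show -q = δ / 2 - 1 by rw [hq]; ring] at hL
  have hW := h ψ hψr
  generalize wNorm Ω (δ / 2 - 1) ψ = W at *
  generalize wGradNorm Ω (δ / 2) ψ = G at *
  generalize L2N ψ = L at *
  rcases eq_or_ne G ⊤ with rfl | hG
  · rw [ENNReal.mul_top (by simpa using hb')]
    exact le_top
  have hLtop : L ≠ ⊤ := ne_top_of_le_ne_top (ENNReal.mul_ne_top ENNReal.ofReal_ne_top hWtop) hL
  lift W to NNReal using hWtop
  lift G to NNReal using hG
  lift L to NNReal using hLtop
  have hLr : (L : ℝ) ≤ s ^ q * W := by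
    have := ENNReal.toReal_mono (by finiteness) hL
    simpa [ENNReal.toReal_ofReal (Real.rpow_nonneg hs0.le q)] using this
  have hWr : (W : ℝ) ≤ b * G + c * L := by
    have := ENNReal.toReal_mono (by finiteness) hW
    rw [ENNReal.toReal_add (by finiteness) (by finiteness)] at this
    simpa [ENNReal.toReal_ofReal hb.le, ENNReal.toReal_ofReal hc.le] using this
  have hcL : c * (L : ℝ) ≤ (1 - b / b') * W := by
    calc c * (L : ℝ) ≤ c * (η * W) := by gcongr; exact hLr.trans (by gcongr)
      _ = (1 - b / b') * W := by rw [hη]; field_simp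
  have hfin : (W : ℝ) ≤ b' * G := by
    have h1 : b / b' * W ≤ b * G := by linarith
    have h2 : b * (W : ℝ) ≤ b * (b' * G) := by
      calc b * (W : ℝ) = b' * (b / b' * W) := by field_simp
        _ ≤ b' * (b * G) := by gcongr
        _ = b * (b' * G) := by ring
    exact le_of_mul_le_mul_left h2 hb
  have h3 := ENNReal.ofReal_le_ofReal hfin
  rwa [ENNReal.ofReal_mul hb'.le, ENNReal.ofReal_coe_nnreal, ENNReal.ofReal_coe_nnreal] at h3

theorem hardyConstOn_eq_weakConstOn {d : ℕ} {Ω : Set (EuclideanSpace ℝ (Fin d))}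
    (hΩ : IsDomainSet Ω) {δ : ℝ} (hδ : δ < 2) (U : Set (EuclideanSpace ℝ (Fin d))) :
    hardyConstOn Ω δ U = weakConstOn Ω δ U := by
  refine le_antisymm (le_sInf ?_) (le_iInf₂ fun r hr => le_sInf ?_)
  · rintro _ ⟨b, c, r, hb, hc, hr, rfl, hW⟩
    refine ENNReal.le_of_forall_pos_le_add fun ε hε _ => ?_
    obtain ⟨s, hs, hB⟩ := hW.exists_bHardy hΩ hδ hb
      (lt_add_of_pos_right b (NNReal.coe_pos.2 hε)) hc hr
    have hS : hardyConstS Ω δ (bdryLayer Ω s ∩ U) ≤ ENNReal.ofReal (b + ε) :=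
      sInf_le ⟨b + ε, by positivity, rfl, hB⟩
    refine (iInf₂_le s hs).trans (hS.trans_eq ?_)
    rw [ENNReal.ofReal_add hb.le ε.coe_nonneg, ENNReal.ofReal_coe_nnreal]
  · rintro _ ⟨a, ha, rfl, hB⟩
    have hW : WHardy Ω δ (bdryLayer Ω r ∩ U) a 1 := fun ψ hψ => (hB ψ hψ).trans le_self_add
    exact sInf_le ⟨a, 1, r, ha, one_pos, hr, rfl, hW⟩

/-- A weak Hardy inequality on a boundary layer extends to the whole domain, with the same
leading constant. -/
theorem WHardy.exists_domain {d : ℕ} {Ω : Set (EuclideanSpace ℝ (Fin d))}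
    {δ : ℝ} (hδ : δ ∈ Set.Ico (0 : ℝ) 2) {b c r : ℝ} (hb : 0 < b) (hc : 0 < c) (hr : 0 < r)
    (h : WHardy Ω δ (bdryLayer Ω r) b c) :
    ∃ c' > 0, WHardy Ω δ Ω b c' := by
  obtain ⟨χ, C, hC, hχ, hχ01, hχC, hχ1, hχ0⟩ := exists_contDiff_cutoff_infDist (frontier Ω) hr
  set K : ℝ := r ^ (δ / 2) * C with hK
  have hK0 : 0 ≤ K := by positivity
  set M : ℝ := (r / 8) ^ (δ / 2 - 1)
  have hM0 : 0 ≤ M := by positivity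
  refine ⟨b * K + c + M, by positivity, fun ψ hψ => ?_⟩
  have hmeas : ∀ p : ℝ, Measurable fun x => distB Ω x ^ p := fun p =>
    (continuous_distB Ω).measurable.pow_const p
  have hχψ : IsCc1 (bdryLayer Ω r) (fun x => χ x * ψ x) := by
    refine ⟨hχ.mul hψ.1, hψ.2.1.mul_left, fun x hx => ⟨hψ.2.2 (tsupport_mul_subset_right hx), ?_⟩⟩
    have hcl : tsupport (fun x => χ x * ψ x) ⊆ {x | distB Ω x ≤ 5 * r / 8} := by
      refine closure_minimal (fun y hy => ?_) (isClosed_le (continuous_distB Ω) continuous_const)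
      by_contra hlt
      exact hy (by simp [hχ0 y (not_le.1 hlt).le])
    exact (hcl hx).trans_lt (by linarith)
  have hsplit : wNorm Ω (δ / 2 - 1) ψ ≤
      wNorm Ω (δ / 2 - 1) (fun x => χ x * ψ x) + ENNReal.ofReal M * L2N ψ := by
    have hdec : wNorm Ω (δ / 2 - 1) ψ = L2N ((fun x => distB Ω x ^ (δ / 2 - 1) * (χ x * ψ x)) +
        fun x => distB Ω x ^ (δ / 2 - 1) * ((1 - χ x) * ψ x)) := by
      unfold wNorm
      congr 1
      ext x
      simp only [Pi.add_apply]
      ring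
    rw [hdec]
    refine (eLpNorm_add_le ?_ ?_ (by norm_num)).trans (add_le_add le_rfl (L2N_le_mul fun x => ?_))
    · exact ((hmeas _).mul
        (hχ.continuous.mul hψ.1.continuous).measurable).aestronglyMeasurable
    · exact ((hmeas _).mul ((continuous_const.sub hχ.continuous).mul
        hψ.1.continuous).measurable).aestronglyMeasurable
    · rcases le_or_gt (distB Ω x) (r / 8) with hx | hx
      · rw [hχ1 x hx]
        simp only [sub_self, zero_mul, mul_zero, abs_zero]
        positivity
      · rw [abs_mul, abs_mul, abs_of_nonneg (Real.rpow_nonneg (distB_nonneg Ω x) _)]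
        have h1 : |1 - χ x| ≤ 1 := abs_le.2 ⟨by linarith [(hχ01 x).2], by linarith [(hχ01 x).1]⟩
        have h2 : distB Ω x ^ (δ / 2 - 1) ≤ M :=
          Real.rpow_le_rpow_of_nonpos (by positivity) hx.le (by linarith [hδ.2])
        exact mul_le_mul h2 (mul_le_of_le_one_left (abs_nonneg _) h1) (by positivity) hM0
  have hgrad : wGradNorm Ω (δ / 2) (fun x => χ x * ψ x) ≤
      wGradNorm Ω (δ / 2) ψ + ENNReal.ofReal K * L2N ψ := by
    have hpt : ∀ x, ‖distB Ω x ^ (δ / 2) * ‖fderiv ℝ (fun x => χ x * ψ x) x‖‖ ≤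
        ((fun x => distB Ω x ^ (δ / 2) * ‖fderiv ℝ ψ x‖) + fun x => K * |ψ x|) x := by
      intro x
      have hd0 : 0 ≤ distB Ω x ^ (δ / 2) := Real.rpow_nonneg (distB_nonneg Ω x) _
      rw [norm_mul, norm_norm, Real.norm_of_nonneg hd0]
      simp only [Pi.add_apply]
      by_cases hx : x ∈ tsupport (fun x => χ x * ψ x)
      · have hdr : distB Ω x ^ (δ / 2) ≤ r ^ (δ / 2) :=
          Real.rpow_le_rpow (distB_nonneg Ω x) (hχψ.2.2 hx).2.le (by linarith [hδ.1])
        have hf : ‖fderiv ℝ (fun x => χ x * ψ x) x‖ ≤ ‖fderiv ℝ ψ x‖ + C * |ψ x| := by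
          rw [fderiv_fun_mul (hχ.differentiable one_ne_zero x) (hψ.1.differentiable one_ne_zero x)]
          refine (norm_add_le _ _).trans ?_
          rw [norm_smul, norm_smul, Real.norm_of_nonneg (hχ01 x).1, Real.norm_eq_abs,
            mul_comm |ψ x|]
          gcongr
          · exact mul_le_of_le_one_left (norm_nonneg _) (hχ01 x).2
          · exact hχC x
        calc distB Ω x ^ (δ / 2) * ‖fderiv ℝ (fun x => χ x * ψ x) x‖
            ≤ distB Ω x ^ (δ / 2) * (‖fderiv ℝ ψ x‖ + C * |ψ x|) := by gcongr
          _ = distB Ω x ^ (δ / 2) * ‖fderiv ℝ ψ x‖ + distB Ω x ^ (δ / 2) * (C * |ψ x|) := by ring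
          _ ≤ distB Ω x ^ (δ / 2) * ‖fderiv ℝ ψ x‖ + r ^ (δ / 2) * (C * |ψ x|) := by gcongr
          _ = distB Ω x ^ (δ / 2) * ‖fderiv ℝ ψ x‖ + K * |ψ x| := by rw [hK]; ring
      · rw [image_eq_zero_of_notMem_tsupport fun hx' => hx (tsupport_fderiv_subset ℝ hx'),
          norm_zero, mul_zero]
        positivity
    refine (eLpNorm_mono_real hpt).trans ((eLpNorm_add_le ?_ ?_ (by norm_num)).trans
      (add_le_add le_rfl (L2N_le_mul fun x => ?_)))
    · exact ((hmeas _).mul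
        (hψ.1.continuous_fderiv one_ne_zero).norm.measurable).aestronglyMeasurable
    · exact (continuous_const.mul hψ.1.continuous.abs).aestronglyMeasurable
    · rw [abs_mul, abs_abs, abs_of_nonneg hK0]
  have hL : L2N (fun x => χ x * ψ x) ≤ L2N ψ :=
    eLpNorm_mono fun x => by
      rw [norm_mul, Real.norm_of_nonneg (hχ01 x).1]
      exact mul_le_of_le_one_left (norm_nonneg _) (hχ01 x).2
  calc wNorm Ω (δ / 2 - 1) ψ
      ≤ ENNReal.ofReal b * (wGradNorm Ω (δ / 2) ψ + ENNReal.ofReal K * L2N ψ) +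
          ENNReal.ofReal c * L2N ψ + ENNReal.ofReal M * L2N ψ := by
        refine hsplit.trans (add_le_add ((h _ hχψ).trans ?_) le_rfl)
        gcongr
    _ = ENNReal.ofReal b * wGradNorm Ω (δ / 2) ψ +
          ENNReal.ofReal (b * K + c + M) * L2N ψ := by
        rw [ENNReal.ofReal_add (by positivity) hM0, ENNReal.ofReal_add (by positivity) hc.le,
          ENNReal.ofReal_mul hb.le]
        ring

theorem weakConstBdry_eq_weakConstDomain {d : ℕ} (Ω : Set (EuclideanSpace ℝ (Fin d)))
    {δ : ℝ} (hδ : δ ∈ Set.Ico (0 : ℝ) 2) : weakConstBdry Ω δ = weakConstDomain Ω δ := by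
  refine le_antisymm (le_sInf ?_) (le_sInf ?_)
  · rintro _ ⟨b, c, hb, hc, rfl, hW⟩
    exact sInf_le ⟨b, c, 1, hb, hc, one_pos, rfl, fun ψ hψ => hW ψ (hψ.mono fun x hx => hx.1)⟩
  · rintro _ ⟨b, c, r, hb, hc, hr, rfl, hW⟩
    obtain ⟨c', hc', hW'⟩ := hW.exists_domain hδ hb hc hr
    exact sInf_le ⟨b, c', hb, hc', rfl, hW'⟩

/-- If `δ ∈ [0,2)` and the boundary Hardy inequality holds on some `Γ_r`,
then `a_δ(Γ) = b_δ(Γ) = b_δ(Ω)` and `a_δ(Γ∩U) = b_δ(Γ∩U)` for every bounded open `U`. -/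
theorem stmt2 {d : ℕ} (hd : 1 ≤ d) (Ω : Set (EuclideanSpace ℝ (Fin d)))
    (hΩ : IsDomainSet Ω) (δ : ℝ) (hδ : δ ∈ Set.Ico (0:ℝ) 2)
    (h : ∃ r > (0:ℝ), ∃ a > (0:ℝ), BHardy Ω δ (bdryLayer Ω r) a) :
    hardyConst Ω δ = weakConstBdry Ω δ ∧
    weakConstBdry Ω δ = weakConstDomain Ω δ ∧
    ∀ U : Set (EuclideanSpace ℝ (Fin d)), IsOpen U → Bornology.IsBounded U →
      hardyConstOn Ω δ U = weakConstOn Ω δ U := by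
  refine ⟨?_, weakConstBdry_eq_weakConstDomain Ω hδ,
    fun U _ _ => hardyConstOn_eq_weakConstOn hΩ hδ.2 U⟩
  simpa [hardyConstOn, weakConstOn, hardyConst, weakConstBdry] using
    hardyConstOn_eq_weakConstOn hΩ hδ.2 Set.univ
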